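/- Conversely, if c is not a local minimum of a polynomial f: ℝ^d → ℝ, then c ∈ cl(Σ_c⁻) where Σ_c⁻ = {x ≠ c : ∇f(x) ∥ x − c, f(x) < f(c)}; hence by the Curve Selection Lemma there exists a real analytic curve γ: [0,1) → ℝ^d with γ(0) = c and γ(t) ∈ Σ_c⁻ for t > 0. -/

import Mathlib

/-- The lower radial set of `f = eval p` relative to `c`: points `x ≠ c` at
which `∇f(x)` and `x − c` are parallel and `f(x) < f(c)`. -/
def lowerRadialSet {d : ℕ} (p : MvPolynomial (Fin d) ℝ) (c : Fin d → ℝ) :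
    Set (Fin d → ℝ) :=
  {x | x ≠ c ∧ (∀ i j : Fin d,
    MvPolynomial.eval x (MvPolynomial.pderiv i p) * (x j - c j)
      - MvPolynomial.eval x (MvPolynomial.pderiv j p) * (x i - c i) = 0) ∧
    MvPolynomial.eval x p < MvPolynomial.eval c p}

open Filter Topology

/-- Families of polynomials of bounded degree with analytic coefficients. -/
structure AnFam (F : ℝ → Polynomial ℝ) (n : ℕ) : Prop where
  deg : ∀ t, (F t).natDegree ≤ n
  an : ∀ j, AnalyticAt ℝ (fun t => (F t).coeff j) 0

theorem AnFam.eval_analytic {F : ℝ → Polynomial ℝ} {n : ℕ} (hF : AnFam F n) (y : ℝ) :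
    AnalyticAt ℝ (fun v : ℝ × ℝ => (F v.1).eval v.2) (0, y) := by
  have h : (fun v : ℝ × ℝ => (F v.1).eval v.2)
      = fun v => ∑ j ∈ Finset.range (n + 1), (F v.1).coeff j * v.2 ^ j := by
    funext v
    exact Polynomial.eval_eq_sum_range' (Nat.lt_succ_of_le (hF.deg _)) _
  rw [h]
  refine Finset.analyticAt_fun_sum _ fun j _ => ?_
  refine AnalyticAt.mul ?_ (analyticAt_snd.pow j)
  exact AnalyticAt.comp (g := fun t => (F t).coeff j) (f := Prod.fst) (by exact hF.an j) analyticAt_fst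

theorem AnFam.eval_analytic' {F : ℝ → Polynomial ℝ} {n : ℕ} (hF : AnFam F n) {φ : ℝ → ℝ}
    (hφ : AnalyticAt ℝ φ 0) : AnalyticAt ℝ (fun t => (F t).eval (φ t)) 0 :=
  AnalyticAt.comp (g := fun v : ℝ × ℝ => (F v.1).eval v.2) (f := fun t => (t, φ t))
    (hF.eval_analytic (φ 0)) (analyticAt_id.prod hφ)

theorem AnFam.hasse {F : ℝ → Polynomial ℝ} {n : ℕ} (hF : AnFam F n) (k : ℕ) :
    AnFam (fun t => Polynomial.hasseDeriv k (F t)) n where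
  deg t := (Polynomial.natDegree_hasseDeriv_le _ _).trans ((Nat.sub_le _ _).trans (hF.deg t))
  an j := by
    simp only [Polynomial.hasseDeriv_coeff]
    exact analyticAt_const.mul (hF.an _)

theorem AnFam.taylor {F : ℝ → Polynomial ℝ} {n : ℕ} (hF : AnFam F n) {φ : ℝ → ℝ}
    (hφ : AnalyticAt ℝ φ 0) : AnFam (fun t => Polynomial.taylor (φ t) (F t)) n where
  deg t := by rw [Polynomial.natDegree_taylor]; exact hF.deg t
  an j := by
    simp only [Polynomial.taylor_coeff]
    exact (hF.hasse j).eval_analytic' hφ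

theorem AnFam.ift {F : ℝ → Polynomial ℝ} {n : ℕ} (hF : AnFam F n)
    (h0 : (F 0).coeff 0 = 0) (h1 : (F 0).coeff 1 ≠ 0) :
    ∃ φ : ℝ → ℝ, AnalyticAt ℝ φ 0 ∧ φ 0 = 0 ∧ ∀ᶠ t in 𝓝 0, (F t).eval (φ t) = 0 := by
  set f : ℝ × ℝ → ℝ := fun v => (F v.1).eval v.2 with hf
  have ha : AnalyticAt ℝ f (0, 0) := hF.eval_analytic 0
  have cdf : ContDiffAt ℝ ⊤ f (0, 0) := ha.contDiffAt
  have hd : fderiv ℝ f (0, 0) (0, 1) = (F 0).coeff 1 := by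
    have e1 : HasDerivAt (fun y : ℝ => f (0, y)) (fderiv ℝ f (0, 0) (0, 1)) 0 := by
      have := (ha.differentiableAt.hasFDerivAt).comp_hasDerivAt_of_eq (0 : ℝ)
        ((hasDerivAt_const (0:ℝ) (0:ℝ)).prodMk (hasDerivAt_id (0 : ℝ))) (by simp)
      exact this
    have e2 : HasDerivAt (fun y : ℝ => f (0, y)) ((F 0).derivative.eval 0) 0 :=
      (F 0).hasDerivAt 0
    rw [e1.unique e2, ← Polynomial.coeff_zero_eq_eval_zero, Polynomial.coeff_derivative]
    simp
  have inv : (fderiv ℝ f (0, 0) ∘L .inr ℝ ℝ ℝ).IsInvertible := by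
    refine ⟨ContinuousLinearEquiv.unitsEquivAut ℝ (Units.mk0 _ h1), ?_⟩
    ext
    simp [hd]
  have hne : (⊤ : WithTop ℕ∞) ≠ 0 := by simp
  refine ⟨cdf.implicitFunction hne inv, ?_, ?_, ?_⟩
  · exact (cdf.contDiffAt_implicitFunction hne inv).analyticAt
  · exact cdf.implicitFunction_apply_self hne inv
  · filter_upwards [cdf.eventually_apply_implicitFunction hne inv] with t ht
    have : f (0, 0) = 0 := by simp [hf, ← Polynomial.coeff_zero_eq_eval_zero, h0]
    rw [this] at ht
    exact ht

theorem AnFam.tschirnhaus {F : ℝ → Polynomial ℝ} {n m : ℕ} (hF : AnFam F n)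
    (h0 : (F 0).coeff m = 0) (h1 : (F 0).coeff (m + 1) ≠ 0) :
    ∃ φ : ℝ → ℝ, AnalyticAt ℝ φ 0 ∧ φ 0 = 0 ∧
      ∀ᶠ t in 𝓝 0, (Polynomial.taylor (φ t) (F t)).coeff m = 0 := by
  simp only [Polynomial.taylor_coeff]
  apply (hF.hasse m).ift
  · simp [Polynomial.hasseDeriv_coeff, h0]
  · rw [Polynomial.hasseDeriv_coeff, add_comm 1 m]
    refine mul_ne_zero ?_ h1
    simp
    positivity

theorem analytic_factor {a : ℝ → ℝ} (ha : AnalyticAt ℝ a 0) :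
    ∃ (ν : ℕ) (c : ℝ → ℝ), AnalyticAt ℝ c 0 ∧ (c 0 ≠ 0 ∨ c = 0) ∧
      ∀ᶠ t in 𝓝 0, a t = t ^ ν * c t := by
  by_cases h : analyticOrderAt a 0 = ⊤
  · refine ⟨0, 0, analyticAt_const, Or.inr rfl, ?_⟩
    simpa using analyticOrderAt_eq_top.1 h
  · obtain ⟨g, hg, hg0, he⟩ := ha.analyticOrderAt_ne_top.1 h
    exact ⟨_, g, hg, Or.inl hg0, by filter_upwards [he] with t ht; simpa using ht⟩

/-- a root of a reduced polynomial has smaller multiplicity -/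
theorem reduced_mult {g : Polynomial ℝ} {m : ℕ} (hd : g.natDegree ≤ m + 1) (hm : g.coeff (m + 1) ≠ 0)
    (hm1 : g.coeff m = 0) (hj : ∃ j < m + 1, g.coeff j ≠ 0) (z : ℝ) :
    ∃ k < m + 1, (Polynomial.taylor z g).coeff k ≠ 0 ∧
      ∀ j < k, (Polynomial.taylor z g).coeff j = 0 := by
  classical
  have key : ∃ k < m + 1, (Polynomial.taylor z g).coeff k ≠ 0 := by
    by_contra! hcon
    set T := Polynomial.taylor z g with hT
    have hTd : T.natDegree ≤ m + 1 := by rw [hT, Polynomial.natDegree_taylor]; exact hd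
    have hTe : T = Polynomial.C (T.coeff (m+1)) * Polynomial.X ^ (m+1) := by
      ext k
      rw [Polynomial.coeff_C_mul_X_pow]
      split_ifs with h
      · rw [h]
      · rcases lt_or_gt_of_ne h with h | h
        · exact hcon k h
        · exact Polynomial.coeff_eq_zero_of_natDegree_lt (by omega)
    have hg : g = Polynomial.C (T.coeff (m+1)) * (Polynomial.X + Polynomial.C (-z)) ^ (m+1) := by
      have : g = Polynomial.taylor (-z) T := by
        rw [hT, Polynomial.taylor_taylor]; simp
      rw [this]
      conv_lhs => rw [hTe]
      rw [Polynomial.taylor_mul, Polynomial.taylor_X_pow, Polynomial.taylor_C]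
    have hc : ∀ k, g.coeff k = T.coeff (m+1) * ((-z) ^ (m + 1 - k) * ((m+1).choose k : ℝ)) := by
      intro k
      conv_lhs => rw [hg]
      rw [Polynomial.coeff_C_mul, Polynomial.coeff_X_add_C_pow]
    have hT0 : T.coeff (m+1) ≠ 0 := by
      intro h
      apply hm
      rw [hc, h, zero_mul]
    have hz : z = 0 := by
      have := hc m
      rw [hm1] at this
      have h2 : ((m+1).choose m : ℝ) ≠ 0 := by simp; positivity
      simp [hT0] at this
      rcases this with h | h
      · exact h
      · exfalso; apply h2; simp [h]
    obtain ⟨j, hj, hj0⟩ := hj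
    apply hj0
    rw [hc, hz, neg_zero, zero_pow (by omega)]
    simp
  refine ⟨Nat.find key, (Nat.find_spec key).1, (Nat.find_spec key).2, fun j hj => ?_⟩
  by_contra h
  exact Nat.find_min key hj ⟨hj.trans (Nat.find_spec key).1, h⟩


theorem AnFam.ofCoeff {b : ℕ → ℝ → ℝ} (hb : ∀ l, AnalyticAt ℝ (b l) 0) (n : ℕ) :
    ∃ F, AnFam F n ∧ ∀ t l, (F t).coeff l = if l < n + 1 then b l t else 0 := by
  have hc : ∀ t l, (∑ l ∈ Finset.range (n+1), Polynomial.C (b l t) * Polynomial.X ^ l).coeff l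
      = if l < n + 1 then b l t else 0 := by
    intro t l
    simp only [Polynomial.finsetSum_coeff, Polynomial.coeff_C_mul_X_pow]
    rw [Finset.sum_ite_eq]
    simp
  refine ⟨fun t => ∑ l ∈ Finset.range (n+1), Polynomial.C (b l t) * Polynomial.X ^ l,
    ⟨fun t => ?_, fun j => ?_⟩, hc⟩
  · rw [Polynomial.natDegree_le_iff_coeff_eq_zero]
    intro N hN
    rw [hc, if_neg (by omega)]
  · simp only [hc]
    split_ifs
    · exact hb j
    · exact analyticAt_const

theorem AnFam.eval_split {G : ℝ → Polynomial ℝ} {M n : ℕ} (hG : AnFam G (M + n)) (t y : ℝ) :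
    (G t).eval y = (∑ l ∈ Finset.range M, (G t).coeff l * y ^ l)
      + y ^ M * ∑ k ∈ Finset.range (n+1), (G t).coeff (M + k) * y ^ k := by
  rw [Polynomial.eval_eq_sum_range' (Nat.lt_succ_of_le (hG.deg t)), Nat.succ_eq_add_one, add_assoc,
    Finset.sum_range_add, Finset.mul_sum]
  congr 1
  refine Finset.sum_congr rfl fun k _ => ?_
  ring

theorem AnFam.tail_tendsto {G : ℝ → Polynomial ℝ} {M n : ℕ} (hG : AnFam G (M + n))
    {ι : Type*} {U : Filter ι} {t y : ι → ℝ} (ht : Tendsto t U (𝓝 0)) (hy : Tendsto y U (𝓝 0)) :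
    Tendsto (fun i => ∑ k ∈ Finset.range (n+1), (G (t i)).coeff (M + k) * y i ^ k) U
      (𝓝 ((G 0).coeff M)) := by
  have : (G 0).coeff M = ∑ k ∈ Finset.range (n+1), (G 0).coeff (M + k) * (0:ℝ) ^ k := by
    rw [Finset.sum_range_succ']
    simp
  rw [this]
  refine tendsto_finsetSum _ fun k _ => ?_
  exact (((hG.an (M+k)).continuousAt.tendsto).comp ht).mul (hy.pow k)

theorem AnFam.step {G : ℝ → Polynomial ℝ} {m n : ℕ} (hG : AnFam G (m + 1 + n))
    (h0 : ∀ j < m + 1, (G 0).coeff j = 0) (hm : (G 0).coeff (m + 1) ≠ 0)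
    (hm1 : ∀ᶠ t in 𝓝 0, (G t).coeff m = 0) :
    (∀ j < m + 1, ∀ᶠ t in 𝓝 0, (G t).coeff j = 0) ∨
    ∃ (p q : ℕ) (F : ℝ → Polynomial ℝ), 0 < p ∧ 0 < q ∧ AnFam F (m + 1 + n) ∧
      (∀ᶠ τ in 𝓝[>] (0:ℝ), ∀ l < m + 1, (G (τ ^ q)).coeff l = τ ^ (p * (m + 1 - l)) * (F τ).coeff l) ∧
      (∀ τ k, k < n + 1 → (F τ).coeff (m + 1 + k) = (G (τ ^ q)).coeff (m + 1 + k) * τ ^ (p * k)) ∧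
      (F 0).natDegree ≤ m + 1 ∧ (F 0).coeff (m + 1) ≠ 0 ∧ (F 0).coeff m = 0 ∧
      ∃ j < m + 1, (F 0).coeff j ≠ 0 := by
  classical
  choose ν c hc hc0 hac using fun j => analytic_factor (hG.an j)
  set J := (Finset.range (m+1)).filter (fun j => c j 0 ≠ 0) with hJ
  by_cases hJe : J = ∅
  · left
    intro j hj
    have : c j = 0 := by
      refine (hc0 j).resolve_left fun h => ?_
      have : j ∈ J := by simp [hJ, h, hj]
      simp [hJe] at this
    filter_upwards [hac j] with t ht
    simp [ht, this]
  right
  have hJn : J.Nonempty := Finset.nonempty_iff_ne_empty.2 hJe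
  set q := (m+1).factorial with hq
  obtain ⟨j0, hj0, hmin⟩ := Finset.exists_min_image J (fun j => ν j * (q / (m + 1 - j))) hJn
  set p := ν j0 * (q / (m + 1 - j0)) with hp
  have hdvd : ∀ j < m + 1, q / (m + 1 - j) * (m + 1 - j) = q := fun j hj =>
    Nat.div_mul_cancel (Nat.dvd_factorial (by omega) (by omega))
  have hJl : ∀ j ∈ J, j < m + 1 := fun j hj => by
    have := (Finset.mem_filter.1 hj).1; simpa using this
  have hJc : ∀ j ∈ J, c j 0 ≠ 0 := fun j hj => (Finset.mem_filter.1 hj).2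
  have hνpos : ∀ j ∈ J, 0 < ν j := by
    intro j hj
    by_contra hn
    have hn0 : ν j = 0 := by omega
    have := (hac j).self_of_nhds
    rw [h0 j (hJl j hj), hn0] at this
    exact hJc j hj (by simpa using this.symm)
  have hqpos : 0 < q := Nat.factorial_pos _
  have hppos : 0 < p := by
    refine Nat.mul_pos (hνpos _ hj0) ?_
    have := hdvd j0 (hJl _ hj0)
    rcases Nat.eq_zero_or_pos (q / (m+1-j0)) with h | h
    · rw [h] at this; omega
    · exact h
  have hle : ∀ j ∈ J, p * (m + 1 - j) ≤ q * ν j := by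
    intro j hj
    calc p * (m+1-j) ≤ (ν j * (q / (m + 1 - j))) * (m+1-j) := Nat.mul_le_mul_right _ (hmin j hj)
      _ = q * ν j := by rw [mul_assoc, hdvd j (hJl j hj), mul_comm]
  have heq : p * (m + 1 - j0) = q * ν j0 := by
    rw [hp, mul_assoc, hdvd j0 (hJl _ hj0), mul_comm]
  have hpowan : AnalyticAt ℝ (fun τ : ℝ => τ ^ q) 0 := analyticAt_id.pow q
  have hcomp : ∀ g : ℝ → ℝ, AnalyticAt ℝ g 0 → AnalyticAt ℝ (fun τ : ℝ => g (τ ^ q)) 0 := by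
    intro g hg
    refine AnalyticAt.comp_of_eq (g := g) hg hpowan ?_
    simp [hqpos.ne']
  obtain ⟨F, hF, hFc⟩ := AnFam.ofCoeff (b := fun l τ => if l < m + 1 then
      τ ^ (q * ν l - p * (m + 1 - l)) * c l (τ ^ q)
      else (G (τ ^ q)).coeff l * τ ^ (p * (l - (m + 1)))) (by
    intro l
    by_cases hl : l < m + 1
    · simp only [hl, if_true]
      exact (analyticAt_id.pow _).mul (hcomp _ (hc l))
    · simp only [hl, if_false]
      exact (hcomp _ (hG.an l)).mul (analyticAt_id.pow _)) (m + 1 + n)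
  have hFlow : ∀ τ, ∀ l < m + 1, (F τ).coeff l = τ ^ (q * ν l - p * (m + 1 - l)) * c l (τ ^ q) := by
    intro τ l hl
    rw [hFc, if_pos (by omega), if_pos hl]
  have hFhigh : ∀ τ k, k < n + 1 →
      (F τ).coeff (m + 1 + k) = (G (τ ^ q)).coeff (m + 1 + k) * τ ^ (p * k) := by
    intro τ k hk
    rw [hFc, if_pos (by omega), if_neg (by omega), Nat.add_sub_cancel_left]
  have hcJ : ∀ j < m + 1, j ∉ J → c j = 0 := by
    intro j hj hjJ
    refine (hc0 j).resolve_left fun h => hjJ ?_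
    simp [hJ, h, hj]
  refine ⟨p, q, F, hppos, hqpos, hF, ?_, hFhigh, ?_, ?_, ?_, ?_⟩
  · have htend : Tendsto (fun τ : ℝ => τ ^ q) (𝓝[>] 0) (𝓝 0) := by
      have := hpowan.continuousAt.tendsto
      simp only [zero_pow hqpos.ne'] at this
      exact this.mono_left nhdsWithin_le_nhds
    have hall : ∀ᶠ t in 𝓝 (0:ℝ), ∀ l ∈ Finset.range (m+1), (G t).coeff l = t ^ ν l * c l t := by
      rw [Finset.eventually_all]
      exact fun l _ => hac l
    filter_upwards [htend.eventually hall] with τ hτ l hl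
    rw [hτ l (by simpa using hl), hFlow τ l hl]
    by_cases hlJ : l ∈ J
    · rw [← mul_assoc, ← pow_mul, ← pow_add]
      congr 2
      have := hle l hlJ
      omega
    · simp [hcJ l hl hlJ]
  · rw [Polynomial.natDegree_le_iff_coeff_eq_zero]
    intro N hN
    rw [hFc]
    split_ifs with h1 h2
    · omega
    · rw [zero_pow (mul_pos hppos (by omega)).ne', mul_zero]
    · rfl
  · have := hFhigh 0 0 (by omega)
    simp only [add_zero, mul_zero, pow_zero, mul_one, zero_pow hqpos.ne'] at this
    rw [this]; exact hm
  · have hmJ : m ∉ J := by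
      intro hmJ
      have hcm := hJc m hmJ
      have h1 := (hc m).continuousAt.eventually_ne hcm
      have h2 : ∀ᶠ t in 𝓝[≠] (0:ℝ), False := by
        filter_upwards [nhdsWithin_le_nhds hm1, nhdsWithin_le_nhds h1,
          nhdsWithin_le_nhds (hac m), self_mem_nhdsWithin] with t a1 a2 a3 a4
        rw [a1] at a3
        exact mul_ne_zero (pow_ne_zero _ a4) a2 a3.symm
      exact h2.exists.elim fun _ h => h
    rw [hFlow 0 m (by omega), hcJ m (by omega) hmJ]
    simp
  · refine ⟨j0, hJl _ hj0, ?_⟩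
    rw [hFlow 0 j0 (hJl _ hj0), heq, Nat.sub_self, pow_zero, one_mul, zero_pow hqpos.ne']
    exact hJc _ hj0

/-- boundedness of the blown up variable -/
theorem AnFam.bounded {G F : ℝ → Polynomial ℝ} {m n p q : ℕ} (hG : AnFam G (m + 1 + n))
    (hF : AnFam F (m + 1 + n)) (hm : (G 0).coeff (m + 1) ≠ 0) 
    {ι : Type*} {U : Filter ι} {τ z : ι → ℝ} (hτ : Tendsto τ U (𝓝[>] 0))
    (hq : 0 < q) (hy : Tendsto (fun i => τ i ^ p * z i) U (𝓝 0))
    (hlow : ∀ᶠ τ in 𝓝[>] (0:ℝ), ∀ l < m + 1, (G (τ ^ q)).coeff l = τ ^ (p * (m + 1 - l)) * (F τ).coeff l)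
    (hz : ∀ᶠ i in U, (G (τ i ^ q)).eval (τ i ^ p * z i) = 0) :
    ∃ C, ∀ᶠ i in U, |z i| ≤ C := by
  have hτ0 : Tendsto τ U (𝓝 0) := hτ.mono_right nhdsWithin_le_nhds
  have ht : Tendsto (fun i => τ i ^ q) U (𝓝 0) := by
    have := hτ0.pow q
    rwa [zero_pow hq.ne'] at this
  have hu := (hG.tail_tendsto ht hy).abs
  set A := |(G 0).coeff (m+1)| with hA
  have hApos : 0 < A := abs_pos.2 hm
  have hS : Tendsto (fun i => ∑ l ∈ Finset.range (m+1), |(F (τ i)).coeff l|) U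
      (𝓝 (∑ l ∈ Finset.range (m+1), |(F 0).coeff l|)) :=
    tendsto_finsetSum _ fun l _ => (((hF.an l).continuousAt.tendsto).comp hτ0).abs
  set S0 := ∑ l ∈ Finset.range (m+1), |(F 0).coeff l| with hS0
  have hS0n : 0 ≤ S0 := Finset.sum_nonneg fun _ _ => abs_nonneg _
  refine ⟨1 + (S0 + 1) / (A / 2), ?_⟩
  filter_upwards [hu.eventually (lt_mem_nhds (half_lt_self hApos)),
    hS.eventually (gt_mem_nhds (lt_add_one S0)), hτ.eventually hlow, hz,
    hτ.eventually self_mem_nhdsWithin] with i h1 h2 h3 h4 h5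
  have h5' : 0 < τ i := h5
  rcases le_or_gt |z i| 1 with hz1 | hz1
  · have : 0 ≤ (S0 + 1) / (A / 2) := by positivity
    linarith
  set u := ∑ k ∈ Finset.range (n+1), (G (τ i ^ q)).coeff (m + 1 + k) * (τ i ^ p * z i) ^ k with hu'
  have e : (∑ l ∈ Finset.range (m+1), (F (τ i)).coeff l * z i ^ l) + z i ^ (m+1) * u = 0 := by
    rw [hG.eval_split, ← hu'] at h4
    have hpos : (τ i ^ (p * (m+1))) ≠ 0 := by positivity
    apply mul_left_cancel₀ hpos
    rw [mul_zero, ← h4, mul_add, Finset.mul_sum]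
    congr 1
    · refine Finset.sum_congr rfl fun l hl => ?_
      have hl' : l < m + 1 := by simpa using hl
      rw [h3 l hl', mul_pow, ← pow_mul]
      have : p * (m+1) = p * (m + 1 - l) + p * l := by
        rw [← mul_add]; congr 1; omega
      rw [this, pow_add]; ring
    · rw [mul_pow, ← pow_mul]; ring
  have e2 : |z i| ^ (m+1) * |u| ≤ (S0 + 1) * |z i| ^ m := by
    have : z i ^ (m+1) * u = - ∑ l ∈ Finset.range (m+1), (F (τ i)).coeff l * z i ^ l := by linarith
    rw [← abs_pow, ← abs_mul, this, abs_neg]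
    calc _ ≤ ∑ l ∈ Finset.range (m+1), |(F (τ i)).coeff l * z i ^ l| := Finset.abs_sum_le_sum_abs _ _
      _ ≤ ∑ l ∈ Finset.range (m+1), |(F (τ i)).coeff l| * |z i| ^ m := by
        refine Finset.sum_le_sum fun l hl => ?_
        rw [abs_mul, abs_pow]
        have : l ≤ m := by have := Finset.mem_range.1 hl; omega
        exact mul_le_mul_of_nonneg_left (pow_le_pow_right₀ hz1.le this) (abs_nonneg _)
      _ = (∑ l ∈ Finset.range (m+1), |(F (τ i)).coeff l|) * |z i| ^ m := by rw [Finset.sum_mul]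
      _ ≤ _ := by gcongr
  have hzm : 0 < |z i| ^ m := by positivity
  have e3 : |z i| * |u| ≤ S0 + 1 := by
    rw [pow_succ] at e2
    by_contra hcon
    push Not at hcon
    nlinarith
  have e4 : |z i| * (A/2) ≤ S0 + 1 := by
    refine le_trans ?_ e3
    gcongr
  have : |z i| ≤ (S0 + 1) / (A/2) := by rw [le_div_iff₀ (by positivity)]; exact e4
  linarith

theorem puiseux_fam {ι : Type*} (U : Ultrafilter ι) (m : ℕ) : ∀ (n : ℕ) (F : ℝ → Polynomial ℝ),
    AnFam F n → (∀ j < m, (F 0).coeff j = 0) → (F 0).coeff m ≠ 0 →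
    ∀ (t y : ι → ℝ), Tendsto t U (𝓝[>] 0) → Tendsto y U (𝓝 0) →
    (∀ᶠ i in U, (F (t i)).eval (y i) = 0) →
    ∃ N : ℕ, 0 < N ∧ ∃ h : ℝ → ℝ, AnalyticAt ℝ h 0 ∧
      ∀ᶠ i in U, ∀ σ : ℝ, 0 < σ → σ ^ N = t i → y i = h σ := by
  induction m using Nat.strong_induction_on with
  | _ m ih =>
  intro n F hF h0 hm t y ht hy hz
  have ht0 : Tendsto t U (𝓝 0) := ht.mono_right nhdsWithin_le_nhds
  rcases m with _ | m
  · exfalso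
    have h1 : Tendsto (fun i => (F (t i)).eval (y i)) U (𝓝 ((F 0).eval 0)) :=
      ((hF.eval_analytic 0).continuousAt.tendsto).comp (ht0.prodMk_nhds hy)
    have h2 : Tendsto (fun i => (F (t i)).eval (y i)) U (𝓝 0) :=
      tendsto_const_nhds.congr' (by filter_upwards [hz] with i hi; exact hi.symm)
    have := tendsto_nhds_unique h1 h2
    rw [← Polynomial.coeff_zero_eq_eval_zero] at this
    exact hm this
  obtain ⟨φ, hφ, hφ0, hφm⟩ := hF.tschirnhaus (h0 m (by omega)) hm
  set G : ℝ → Polynomial ℝ := fun t => Polynomial.taylor (φ t) (F t) with hGdef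
  have hG0 : G 0 = F 0 := by simp [hGdef, hφ0]
  have hG : AnFam G (m + 1 + n) :=
    ⟨fun t => ((hF.taylor hφ).deg t).trans (by omega), (hF.taylor hφ).an⟩
  set y' : ι → ℝ := fun i => y i - φ (t i) with hy'
  have hφt : Tendsto (fun i => φ (t i)) U (𝓝 0) := by
    have := hφ.continuousAt.tendsto.comp ht0
    rwa [hφ0] at this
  have hy'0 : Tendsto y' U (𝓝 0) := by simpa using hy.sub hφt
  have hz' : ∀ᶠ i in U, (G (t i)).eval (y' i) = 0 := by
    filter_upwards [hz] with i hi
    simp only [hGdef, hy', Polynomial.taylor_eval]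
    simpa using hi
  have hGm : (G 0).coeff (m+1) ≠ 0 := by rw [hG0]; exact hm
  rcases hG.step (by rw [hG0]; exact h0) hGm hφm with hall | hblow
  · refine ⟨1, one_pos, φ, hφ, ?_⟩
    have hall' : ∀ᶠ t in 𝓝 (0:ℝ), ∀ l ∈ Finset.range (m+1), (G t).coeff l = 0 := by
      rw [Finset.eventually_all]
      exact fun l hl => hall l (by simpa using hl)
    filter_upwards [ht0.eventually hall', hz',
      (hG.tail_tendsto ht0 hy'0).eventually_ne hGm] with i h1 h2 h3 σ _ hσ
    rw [hG.eval_split, Finset.sum_eq_zero (fun l hl => by rw [h1 l hl, zero_mul]), zero_add] at h2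
    have := pow_eq_zero_iff (by omega) |>.1 ((mul_eq_zero.1 h2).resolve_right h3)
    rw [pow_one] at hσ
    rw [hσ]
    simp only [hy'] at this
    linarith
  obtain ⟨p, q, F1, hp, hq, hF1, hlow, hhigh, hdeg, hc1, hc2, hc3⟩ := hblow
  set τ : ι → ℝ := fun i => (t i) ^ ((q:ℝ)⁻¹) with hτdef
  have htpos : ∀ᶠ i in U, 0 < t i := ht.eventually self_mem_nhdsWithin
  have hτpos : ∀ᶠ i in U, 0 < τ i := by
    filter_upwards [htpos] with i hi using Real.rpow_pos_of_pos hi _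
  have hτq : ∀ᶠ i in U, τ i ^ q = t i := by
    filter_upwards [htpos] with i hi using Real.rpow_inv_natCast_pow hi.le hq.ne'
  have hτ0 : Tendsto τ U (𝓝 0) := by
    have : Tendsto (fun x : ℝ => x ^ ((q:ℝ)⁻¹)) (𝓝 0) (𝓝 (0 ^ ((q:ℝ)⁻¹))) :=
      (Real.continuousAt_rpow_const 0 _ (Or.inr (by positivity))).tendsto
    rw [Real.zero_rpow (by positivity)] at this
    exact this.comp ht0
  have hτ : Tendsto τ U (𝓝[>] 0) := tendsto_nhdsWithin_iff.2 ⟨hτ0, hτpos⟩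
  set z : ι → ℝ := fun i => y' i / τ i ^ p with hzdef
  have hyz : ∀ᶠ i in U, τ i ^ p * z i = y' i := by
    filter_upwards [hτpos] with i hi
    simp only [hzdef]
    field_simp
  obtain ⟨C, hC⟩ := hG.bounded (p := p) hF1 hGm (z := z) hτ hq (hy'0.congr' (by
    filter_upwards [hyz] with i hi using hi.symm)) hlow (by
    filter_upwards [hyz, hτq, hz'] with i h1 h2 h3
    rw [h1, h2]; exact h3)
  obtain ⟨zs, -, hzs⟩ := (isCompact_Icc (a := -C) (b := C)).ultrafilter_le_nhds (U.map z) (by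
    rw [le_principal_iff]
    show ∀ᶠ i in U, z i ∈ Set.Icc (-C) C
    filter_upwards [hC] with i hi using abs_le.1 hi)
  have hzs' : Tendsto z U (𝓝 zs) := hzs
  have hF1z : ∀ᶠ i in U, (F1 (τ i)).eval (z i) = 0 := by
    filter_upwards [hyz, hτq, hz', hτ.eventually hlow, hτpos] with i h1 h2 h3 h4 h5
    have hpos : (τ i ^ (p * (m+1))) ≠ 0 := by positivity
    apply mul_left_cancel₀ hpos
    rw [mul_zero, ← h3, ← h1, ← h2, hG.eval_split, hF1.eval_split, mul_add, Finset.mul_sum,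
      Finset.mul_sum, Finset.mul_sum, Finset.mul_sum]
    congr 1
    · refine Finset.sum_congr rfl fun l hl => ?_
      have hl' : l < m + 1 := by simpa using hl
      rw [h4 l hl', mul_pow, ← pow_mul]
      have : p * (m+1) = p * (m + 1 - l) + p * l := by
        rw [← mul_add]; congr 1; omega
      rw [this, pow_add]; ring
    · refine Finset.sum_congr rfl fun k hk => ?_
      rw [hhigh _ k (by simpa using hk), mul_pow, mul_pow, ← pow_mul, ← pow_mul]
      ring
  obtain ⟨k, hk, hk0, hkl⟩ := reduced_mult hdeg hc1 hc2 hc3 zs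
  obtain ⟨N, hN, h, hh, hfin⟩ := ih k hk (m + 1 + n) (fun τ => Polynomial.taylor zs (F1 τ))
    (hF1.taylor analyticAt_const) hkl hk0 τ (fun i => z i - zs) hτ
    (by simpa using hzs'.sub_const zs) (by
      filter_upwards [hF1z] with i hi
      rw [Polynomial.taylor_eval]; simpa using hi)
  refine ⟨N * q, Nat.mul_pos hN hq, fun σ => φ (σ ^ (N * q)) + σ ^ (N * p) * (zs + h σ), ?_, ?_⟩
  · refine AnalyticAt.add ?_ ((analyticAt_id.pow _).mul (analyticAt_const.add hh))
    exact AnalyticAt.comp_of_eq (g := φ) hφ (analyticAt_id.pow (N * q))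
      (by simp [hN.ne', hq.ne'])
  · filter_upwards [hfin, hyz, hτq, hτpos] with i h1 h2 h3 h4 σ hσ hσt
    have e1 : σ ^ N = τ i := by
      rw [← h3, pow_mul] at hσt
      exact (pow_left_inj₀ (by positivity) h4.le hq.ne').1 hσt
    have e2 := h1 σ hσ e1
    rw [hσt, pow_mul, e1, ← e2]
    have : zs + (z i - zs) = z i := by ring
    rw [this, h2]
    simp [hy']


open Polynomial in
theorem poly_factor_t (k : ℕ) : ∀ P : Polynomial (Polynomial ℝ), P ≠ 0 → P.leadingCoeff.natDegree = k →
    ∃ (e : ℕ) (P1 : Polynomial (Polynomial ℝ)), P = C (X ^ e) * P1 ∧ P1.map (evalRingHom 0) ≠ 0 := by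
  induction k using Nat.strong_induction_on with
  | _ k ih =>
  intro P hP hk
  by_cases h : P.map (evalRingHom 0) = 0
  · have : C X ∣ P := by
      rw [C_dvd_iff_dvd_coeff]
      intro i
      rw [X_dvd_iff, coeff_zero_eq_eval_zero]
      have := congrArg (fun q => q.coeff i) h
      simpa using this
    obtain ⟨P', rfl⟩ := this
    have hP' : P' ≠ 0 := by rintro rfl; simp at hP
    have hl : P'.leadingCoeff ≠ 0 := leadingCoeff_ne_zero.2 hP'
    have hdeg : P'.leadingCoeff.natDegree < k := by
      rw [← hk, leadingCoeff_mul, leadingCoeff_C, natDegree_X_mul hl]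
      omega
    obtain ⟨e, P1, h1, h2⟩ := ih _ hdeg P' hP' rfl
    exact ⟨e + 1, P1, by rw [h1, ← mul_assoc, ← C_mul, pow_succ']; , h2⟩
  · exact ⟨0, P, by simp, h⟩

theorem puiseux_poly {ι : Type*} (U : Ultrafilter ι) (P : Polynomial (Polynomial ℝ)) (hP : P ≠ 0)
    (t y : ι → ℝ) (ht : Tendsto t U (𝓝[>] 0)) (hy : Tendsto y U (𝓝 0))
    (hz : ∀ᶠ i in U, P.evalEval (t i) (y i) = 0) :
    ∃ N : ℕ, 0 < N ∧ ∃ h : ℝ → ℝ, AnalyticAt ℝ h 0 ∧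
      ∀ᶠ i in U, ∀ σ : ℝ, 0 < σ → σ ^ N = t i → y i = h σ := by
  classical
  obtain ⟨e, P1, rfl, h1⟩ := poly_factor_t _ P hP rfl
  have hex : ∃ m, (P1.map (Polynomial.evalRingHom 0)).coeff m ≠ 0 := by
    by_contra! hcon
    exact h1 (Polynomial.ext (by simpa using hcon))
  refine puiseux_fam U (Nat.find hex) P1.natDegree
    (fun t => P1.map (Polynomial.evalRingHom t)) ⟨fun t => Polynomial.natDegree_map_le, fun j => ?_⟩
    (fun j hj => not_not.1 (Nat.find_min hex hj)) (Nat.find_spec hex) t y ht hy ?_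
  · simp only [Polynomial.coeff_map, Polynomial.coe_evalRingHom]
    simpa using analyticAt_id.aeval_polynomial (P1.coeff j) (z := (0:ℝ)) (𝕜 := ℝ)
  · filter_upwards [hz, ht.eventually self_mem_nhdsWithin] with i hi hpos
    have hpos' : 0 < t i := hpos
    rw [Polynomial.map_evalRingHom_eval]
    rw [Polynomial.evalEval_mul, Polynomial.evalEval_C] at hi
    refine (mul_eq_zero.1 hi).resolve_left ?_
    simp [hpos'.ne']

theorem limit_leading {ι : Type*} {U : Filter ι} [U.NeBot] (W : Polynomial (Polynomial (Polynomial ℝ)))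
    (ρ : ℝ) (s y : ι → ℝ) (y0 : ℝ) (hs : Tendsto s U atTop) (hy : Tendsto y U (𝓝 y0))
    (hz : ∀ᶠ i in U, (W.map (Polynomial.evalEvalRingHom ρ (y i))).eval (s i) = 0) :
    W.leadingCoeff.evalEval ρ y0 = 0 := by
  have hcont : ∀ P : Polynomial (Polynomial ℝ), Continuous fun y => P.evalEval ρ y := by
    intro P
    simp only [← Polynomial.map_evalRingHom_eval]
    exact Polynomial.continuous _
  set K := W.natDegree with hK
  have h1 : Tendsto (fun i => ∑ k ∈ Finset.range (K+1), (W.coeff k).evalEval ρ (y i) * ((s i)⁻¹) ^ (K - k)) U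
      (𝓝 (∑ k ∈ Finset.range (K+1), (W.coeff k).evalEval ρ y0 * (0:ℝ) ^ (K - k))) :=
    tendsto_finsetSum _ fun k _ =>
      (((hcont _).tendsto y0).comp hy).mul ((tendsto_inv_atTop_zero.comp hs).pow _)
  have h2 : (∑ k ∈ Finset.range (K+1), (W.coeff k).evalEval ρ y0 * (0:ℝ) ^ (K - k))
      = W.leadingCoeff.evalEval ρ y0 := by
    rw [Finset.sum_range_succ, Finset.sum_eq_zero]
    · simp [hK]
    · intro k hk
      have : k < K := by simpa using hk
      rw [zero_pow (by omega), mul_zero]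
  rw [h2] at h1
  refine tendsto_nhds_unique h1 (tendsto_const_nhds.congr' ?_)
  filter_upwards [hz, hs.eventually_gt_atTop 0] with i hi hpos
  rw [Polynomial.eval_map, Polynomial.eval₂_eq_sum_range] at hi
  have : (s i)⁻¹ ^ K * (∑ k ∈ Finset.range (K+1), (W.coeff k).evalEval ρ (y i) * s i ^ k) = 0 := by
    have hi' : (∑ k ∈ Finset.range (K+1), (W.coeff k).evalEval ρ (y i) * s i ^ k) = 0 := hi
    rw [hi', mul_zero]
  rw [← this, Finset.mul_sum]
  refine Finset.sum_congr rfl fun k hk => ?_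
  have hk' : k ≤ K := by have := Finset.mem_range.1 hk; omega
  have : (s i)⁻¹ ^ K = (s i)⁻¹ ^ (K - k) * (s i)⁻¹ ^ k := by rw [← pow_add]; congr 1; omega
  rw [this, inv_pow, inv_pow]
  field_simp

theorem swap_eval (Q : Polynomial (Polynomial (Polynomial ℝ))) (ρ s y : ℝ) :
    ((Polynomial.Bivariate.swap Q).map (Polynomial.evalEvalRingHom ρ y)).eval s
      = Q.eval₂ (Polynomial.evalEvalRingHom ρ s) y := by
  have : ((Polynomial.evalRingHom s).comp (Polynomial.mapRingHom (Polynomial.evalEvalRingHom ρ y))).comp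
      (Polynomial.Bivariate.swap (R := Polynomial ℝ)).toAlgHom.toRingHom =
      Polynomial.eval₂RingHom (Polynomial.evalEvalRingHom ρ s) y := by
    ext
    · simp
    · simpa using congrArg (fun q => (q.map (Polynomial.evalEvalRingHom ρ y)).eval s)
        (Polynomial.Bivariate.swap_C_C (R := Polynomial ℝ) Polynomial.X)
    · simpa using congrArg (fun q => (q.map (Polynomial.evalEvalRingHom ρ y)).eval s)
        (Polynomial.Bivariate.swap_X (R := Polynomial ℝ))
    · simpa using congrArg (fun q => (q.map (Polynomial.evalEvalRingHom ρ y)).eval s)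
        (Polynomial.Bivariate.swap_Y (R := Polynomial ℝ))
  exact congrArg (fun f => f Q) this

theorem integral_of_system {d : ℕ} {B A : Type*} [CommRing B] [CommRing A] [Algebra B A]
    (x : Fin d → A) (D : ℕ) (g : Fin d → MvPolynomial (Fin d) B)
    (hdeg : ∀ i, (g i).totalDegree < D) (hx : ∀ i, x i ^ D = MvPolynomial.aeval x (g i)) (i : Fin d) :
    IsIntegral B (x i) := by
  classical
  set mon : (Fin d →₀ ℕ) → A := fun α => ∏ j, x j ^ α j with hmon
  set M : Submodule B A := Submodule.span B (mon '' {α | ∀ j, α j < D}) with hM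
  have hall : ∀ n, ∀ α : Fin d →₀ ℕ, α.degree = n → mon α ∈ M := by
    intro n
    induction n using Nat.strong_induction_on with
    | _ n ih =>
    intro α hα
    by_cases h : ∀ j, α j < D
    · exact Submodule.subset_span ⟨α, h, rfl⟩
    push Not at h
    obtain ⟨j, hj⟩ := h
    set β : Fin d →₀ ℕ := α - Finsupp.single j D with hβ
    have hαβ : α = β + Finsupp.single j D := by
      rw [hβ, tsub_add_cancel_of_le]
      simpa using hj
    have hmul : ∀ a b, mon (a + b) = mon a * mon b := by
      intro a b
      simp [hmon, pow_add, Finset.prod_mul_distrib]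
    have hsing : mon (Finsupp.single j D) = x j ^ D := by
      simp only [hmon]
      rw [Finset.prod_eq_single j]
      · simp
      · intro b _ hb; simp [Finsupp.single_eq_of_ne hb]
      · simp
    rw [hαβ, hmul, hsing, hx j, MvPolynomial.aeval_def, MvPolynomial.eval₂_eq', Finset.mul_sum]
    refine Submodule.sum_mem _ fun e he => ?_
    have : mon β * ((algebraMap B A) (MvPolynomial.coeff e (g j)) * ∏ i, x i ^ e i)
        = MvPolynomial.coeff e (g j) • mon (β + e) := by
      rw [hmul, Algebra.smul_def]
      simp only [hmon]
      ring
    rw [this]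
    refine Submodule.smul_mem _ _ (ih _ ?_ _ rfl)
    have h1 : e.degree < D := lt_of_le_of_lt (MvPolynomial.le_totalDegree he) (hdeg j)
    rw [← hα, hαβ, map_add, map_add, Finsupp.degree_single]
    omega
  have hran : Subalgebra.toSubmodule (MvPolynomial.aeval x : MvPolynomial (Fin d) B →ₐ[B] A).range = M := by
    apply le_antisymm
    · rintro _ ⟨f, rfl⟩
      show MvPolynomial.aeval x f ∈ M
      rw [MvPolynomial.aeval_def, MvPolynomial.eval₂_eq']
      refine Submodule.sum_mem _ fun e he => ?_
      rw [← Algebra.smul_def]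
      exact Submodule.smul_mem _ _ (hall _ e rfl)
    · rw [hM, Submodule.span_le]
      rintro _ ⟨α, -, rfl⟩
      refine ⟨∏ j, MvPolynomial.X j ^ α j, ?_⟩
      simp [hmon]
  refine IsIntegral.of_mem_of_fg (MvPolynomial.aeval x : MvPolynomial (Fin d) B →ₐ[B] A).range ?_ _
    ⟨MvPolynomial.X i, by simp⟩
  rw [hran]
  refine Submodule.fg_span (Set.Finite.image _ ?_)
  refine Set.Finite.subset (Set.finite_Iic (Finsupp.equivFunOnFinite.symm fun _ => D)) ?_
  intro α hα j
  simpa using (hα j).le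


theorem system_algebraic {d : ℕ} (p : MvPolynomial (Fin d) ℝ) (c : Fin d → ℝ) (D : ℕ) (hD3 : 3 < D)
    (hD : ∀ i, (MvPolynomial.pderiv i p).totalDegree < D) (i : Fin d) :
    ∃ W : Polynomial (Polynomial (Polynomial ℝ)), W ≠ 0 ∧ ∀ (ρ s : ℝ) (x : Fin d → ℝ),
      (∀ j, x j ^ D + s * MvPolynomial.eval x (MvPolynomial.pderiv j p)
        + 4 * s ^ 2 * ((∑ k, (x k - c k) ^ 2) - ρ) * (x j - c j) = 0) →
      (W.map (Polynomial.evalEvalRingHom ρ (x i - c i))).eval s = 0 := by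
  classical
  set S := {v : ℝ × ℝ × (Fin d → ℝ) // ∀ j, v.2.2 j ^ D
    + v.2.1 * MvPolynomial.eval v.2.2 (MvPolynomial.pderiv j p)
        + 4 * v.2.1 ^ 2 * ((∑ k, (v.2.2 k - c k) ^ 2) - v.1) * (v.2.2 j - c j) = 0} with hS
  let Φ : Polynomial (Polynomial ℝ) →+* (S → ℝ) :=
    RingHom.pi fun v => Polynomial.evalEvalRingHom v.1.1 v.1.2.1
  let _ : Algebra (Polynomial (Polynomial ℝ)) (S → ℝ) := Φ.toAlgebra
  have hmap : ∀ b v, algebraMap (Polynomial (Polynomial ℝ)) (S → ℝ) b v = b.evalEval v.1.1 v.1.2.1 :=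
    fun b v => rfl
  let x : Fin d → (S → ℝ) := fun j v => v.1.2.2 j
  let cc : ℝ →+* Polynomial (Polynomial ℝ) := Polynomial.C.comp Polynomial.C
  let g : Fin d → MvPolynomial (Fin d) (Polynomial (Polynomial ℝ)) := fun j =>
    -(MvPolynomial.C Polynomial.X * MvPolynomial.map cc (MvPolynomial.pderiv j p)
      + MvPolynomial.C (4 * Polynomial.X ^ 2) *
        ((∑ k, (MvPolynomial.X k - MvPolynomial.C (cc (c k))) ^ 2)
          - MvPolynomial.C (Polynomial.C (Polynomial.X : Polynomial ℝ))) *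
        (MvPolynomial.X j - MvPolynomial.C (cc (c j))))
  have hlin : ∀ j, (MvPolynomial.X j - MvPolynomial.C (cc (c j)) :
      MvPolynomial (Fin d) (Polynomial (Polynomial ℝ))).totalDegree ≤ 1 := by
    intro j
    refine (MvPolynomial.totalDegree_sub _ _).trans ?_
    simp
  have hdeg : ∀ j, (g j).totalDegree < D := by
    intro j
    simp only [g, MvPolynomial.totalDegree_neg]
    refine lt_of_le_of_lt (MvPolynomial.totalDegree_add _ _) (max_lt ?_ ?_)
    · refine lt_of_le_of_lt (MvPolynomial.totalDegree_mul _ _) ?_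
      rw [MvPolynomial.totalDegree_C, zero_add]
      refine lt_of_le_of_lt ?_ (hD j)
      exact Finset.sup_mono (MvPolynomial.support_map_subset _ _)
    · refine lt_of_le_of_lt (?_ : _ ≤ 0 + 2 + 1) (by omega)
      refine (MvPolynomial.totalDegree_mul _ _).trans (Nat.add_le_add ?_ (hlin j))
      refine (MvPolynomial.totalDegree_mul _ _).trans (Nat.add_le_add ?_ ?_)
      · rw [MvPolynomial.totalDegree_C]
      · refine (MvPolynomial.totalDegree_sub _ _).trans (max_le ?_ ?_)
        · refine MvPolynomial.totalDegree_finsetSum_le fun k _ => ?_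
          refine (MvPolynomial.totalDegree_pow _ _).trans ?_
          have := hlin k
          omega
        · rw [MvPolynomial.totalDegree_C]; omega
  have haev : ∀ (f : MvPolynomial (Fin d) (Polynomial (Polynomial ℝ))) (v : S),
      MvPolynomial.aeval x f v
        = MvPolynomial.eval₂ (Polynomial.evalEvalRingHom v.1.1 v.1.2.1) v.1.2.2 f := by
    intro f v
    have : ((Pi.evalRingHom (fun _ : S => ℝ) v).comp
        (MvPolynomial.aeval x : MvPolynomial (Fin d) (Polynomial (Polynomial ℝ)) →ₐ[_] (S → ℝ)).toRingHom)
        = MvPolynomial.eval₂Hom (Polynomial.evalEvalRingHom v.1.1 v.1.2.1) v.1.2.2 := by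
      apply MvPolynomial.ringHom_ext
      · intro r
        simp [hmap]
      · intro j
        simp [x]
    exact congrArg (fun h => h f) this
  have hx : ∀ j, x j ^ D = MvPolynomial.aeval x (g j) := by
    intro j
    funext v
    rw [haev]
    have hv := v.2 j
    have hcc : (Polynomial.evalEvalRingHom v.1.1 v.1.2.1).comp cc = RingHom.id ℝ := by
      ext r; simp [cc]
    have e1 : MvPolynomial.eval₂ (Polynomial.evalEvalRingHom v.1.1 v.1.2.1) v.1.2.2
        (MvPolynomial.map cc (MvPolynomial.pderiv j p))
        = MvPolynomial.eval v.1.2.2 (MvPolynomial.pderiv j p) := by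
      rw [MvPolynomial.eval₂_map, hcc]
      rfl
    have e2 : ∀ r, (cc r).evalEval v.1.1 v.1.2.1 = r := by intro r; simp [cc]
    have e4 : (4 : Polynomial (Polynomial ℝ)).evalEval v.1.1 v.1.2.1 = 4 :=
      map_ofNat (Polynomial.evalEvalRingHom v.1.1 v.1.2.1) 4
    rw [← MvPolynomial.coe_eval₂Hom] at e1
    simp only [g, ← MvPolynomial.coe_eval₂Hom, map_neg, map_add, map_mul, map_sub, map_sum, map_pow, e1]
    simp only [MvPolynomial.coe_eval₂Hom, MvPolynomial.eval₂_C, MvPolynomial.eval₂_X,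
      Polynomial.coe_evalEvalRingHom, e2, e4, Polynomial.evalEval_X, Polynomial.evalEval_mul, 
      Polynomial.evalEval_C, Polynomial.eval_X, Pi.pow_apply, x, Polynomial.evalEval_pow, map_ofNat]
    linarith
  have hint : IsIntegral (Polynomial (Polynomial ℝ)) (x i - algebraMap _ (S → ℝ) (cc (c i))) :=
    (integral_of_system x D g hdeg hx i).sub isIntegral_algebraMap
  obtain ⟨Q, hQ, hQ0⟩ := hint
  refine ⟨Polynomial.Bivariate.swap Q, ?_, ?_⟩
  · rw [Ne, EmbeddingLike.map_eq_zero_iff]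
    exact hQ.ne_zero
  · intro ρ s y hy
    rw [swap_eval]
    let v : S := ⟨(ρ, s, y), hy⟩
    have h1 := congrArg (fun f => f v) hQ0
    have h2 := Polynomial.hom_eval₂ Q (algebraMap (Polynomial (Polynomial ℝ)) (S → ℝ))
      (Pi.evalRingHom (fun _ : S => ℝ) v) (x i - algebraMap _ (S → ℝ) (cc (c i)))
    have h3 : (Pi.evalRingHom (fun _ : S => ℝ) v) (x i - algebraMap _ (S → ℝ) (cc (c i))) = y i - c i := by
      simp [x, hmap, v, cc]
    rw [h3] at h2
    exact h2.symm.trans h1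

theorem mv_hasDerivAt {d : ℕ} (p : MvPolynomial (Fin d) ℝ) (x : Fin d → ℝ) (i : Fin d) :
    HasDerivAt (fun τ : ℝ => MvPolynomial.eval (x + τ • Pi.single i (1:ℝ)) p)
      (MvPolynomial.eval x (MvPolynomial.pderiv i p)) 0 := by
  classical
  induction p using MvPolynomial.induction_on with
  | C a => simpa using hasDerivAt_const (0:ℝ) a
  | add p q hp hq => simpa using hp.fun_add hq
  | mul_X p j hp =>
    have hX : HasDerivAt (fun τ : ℝ => x j + τ * (Pi.single i (1:ℝ) : Fin d → ℝ) j)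
        ((Pi.single i (1:ℝ) : Fin d → ℝ) j) 0 := by
      simpa using ((hasDerivAt_id (0:ℝ)).mul_const ((Pi.single i (1:ℝ) : Fin d → ℝ) j)).const_add (x j)
    have := hp.fun_mul hX
    simp only [map_mul, MvPolynomial.eval_X, Pi.add_apply, Pi.smul_apply, smul_eq_mul,
      Derivation.leibniz, MvPolynomial.pderiv_X, map_add]
    refine this.congr_deriv ?_
    by_cases h : i = j
    · subst h; simp; ring
    · have h' : j ≠ i := fun e => h e.symm
      simp [h, h']; ring

theorem mv_pderiv_zero {d : ℕ} (p : MvPolynomial (Fin d) ℝ) (x : Fin d → ℝ) 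
    (h : IsLocalMin (fun x => MvPolynomial.eval x p) x) (i : Fin d) :
    MvPolynomial.eval x (MvPolynomial.pderiv i p) = 0 := by
  refine IsLocalMin.hasDerivAt_eq_zero (a := (0:ℝ)) ?_ (mv_hasDerivAt p x i)
  have hc : ContinuousAt (fun τ : ℝ => x + τ • (Pi.single i (1:ℝ) : Fin d → ℝ)) 0 := by fun_prop
  have h' : IsLocalMin (fun x => MvPolynomial.eval x p) (x + (0:ℝ) • (Pi.single i (1:ℝ) : Fin d → ℝ)) := by
    simpa using h
  exact hc.eventually h'


theorem exists_point {d : ℕ} (p : MvPolynomial (Fin d) ℝ) (c : Fin d → ℝ) (D : ℕ)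
    (hDe : Even (D+1))
    (W : Fin d → Polynomial (Polynomial (Polynomial ℝ)))
    (hW : ∀ i, ∀ (ρ s : ℝ) (x : Fin d → ℝ), (∀ j, x j ^ D + s * MvPolynomial.eval x (MvPolynomial.pderiv j p) +
        4 * s^2 * ((∑ k, (x k - c k)^2) - ρ) * (x j - c j) = 0) →
        ((W i).map (Polynomial.evalEvalRingHom ρ (x i - c i))).eval s = 0)
    (z0 : Fin d → ℝ) (hz : MvPolynomial.eval z0 p < MvPolynomial.eval c p) :
    ∃ x0 ∈ lowerRadialSet p c, (∑ k, (x0 k - c k)^2) = (∑ k, (z0 k - c k)^2) ∧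
      ∀ i, (W i).leadingCoeff.evalEval (∑ k, (z0 k - c k)^2) (x0 i - c i) = 0 := by
  classical
  set q : (Fin d → ℝ) → ℝ := fun x => ∑ k, (x k - c k)^2 with hq
  set ρ : ℝ := q z0 with hρ
  have hqc : Continuous q := by fun_prop
  have hfc : ∀ r : MvPolynomial (Fin d) ℝ, Continuous (fun x => MvPolynomial.eval x r) :=
    fun r => MvPolynomial.continuous_eval r
  set K : Set (Fin d → ℝ) := {x | q x ≤ ρ + 1} with hKd
  have hρ0 : 0 ≤ ρ := Finset.sum_nonneg fun k _ => sq_nonneg _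
  have hK : IsCompact K := by
    refine Metric.isCompact_of_isClosed_isBounded (isClosed_le hqc continuous_const) ?_
    refine (Metric.isBounded_closedBall (x := c) (r := ρ + 2)).subset ?_
    intro x hx
    rw [Metric.mem_closedBall, dist_pi_le_iff (by linarith)]
    intro k
    rw [Real.dist_eq]
    have h1 : (x k - c k)^2 ≤ q x :=
      Finset.single_le_sum (f := fun k => (x k - c k)^2) (fun k _ => sq_nonneg _) (Finset.mem_univ k)
    have h2 : q x ≤ ρ + 1 := hx
    apply abs_le_of_sq_le_sq _ (by linarith)
    nlinarith
  have hz0K : z0 ∈ K := by show q z0 ≤ ρ + 1; linarith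
  set R : (Fin d → ℝ) → ℝ := fun x => ∑ k, (1/((D:ℝ)+1)) * x k ^ (D+1) with hR
  have hR0 : ∀ x, 0 ≤ R x := fun x => Finset.sum_nonneg fun k _ => by
    have := hDe.pow_nonneg (x k)
    positivity
  set G : ℕ → MvPolynomial (Fin d) ℝ := fun n =>
    MvPolynomial.C (n:ℝ) * p + MvPolynomial.C ((n:ℝ)^2) *
      ((∑ k, (MvPolynomial.X k - MvPolynomial.C (c k))^2) - MvPolynomial.C ρ)^2 +
      ∑ k, MvPolynomial.C (1/((D:ℝ)+1)) * MvPolynomial.X k ^ (D+1) with hG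
  have hGe : ∀ n x, MvPolynomial.eval x (G n) = n * MvPolynomial.eval x p + (n:ℝ)^2 * (q x - ρ)^2 + R x := by
    intro n x
    simp [hG, hq, hR]
  have hGd : ∀ n x j, MvPolynomial.eval x (MvPolynomial.pderiv j (G n)) =
      x j ^ D + n * MvPolynomial.eval x (MvPolynomial.pderiv j p) + 4 * (n:ℝ)^2 * (q x - ρ) * (x j - c j) := by
    intro n x j
    have hD1 : ((D:ℝ)+1) ≠ 0 := by positivity
    have e1 : MvPolynomial.pderiv j (∑ k, MvPolynomial.C (1/((D:ℝ)+1)) * MvPolynomial.X k ^ (D+1) : MvPolynomial (Fin d) ℝ)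
        = MvPolynomial.X j ^ D := by
      rw [map_sum, Finset.sum_eq_single j]
      · rw [MvPolynomial.pderiv_C_mul, MvPolynomial.pderiv_pow, MvPolynomial.pderiv_X_self]
        have : ((D+1 : ℕ) : MvPolynomial (Fin d) ℝ) = MvPolynomial.C ((D:ℝ)+1) := by simp
        rw [this]
        simp only [mul_one, Nat.add_sub_cancel, ← mul_assoc, ← MvPolynomial.C_mul]
        rw [one_div_mul_cancel hD1]; simp
      · intro k _ hk
        rw [MvPolynomial.pderiv_C_mul, MvPolynomial.pderiv_pow, MvPolynomial.pderiv_X_of_ne hk]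
        simp
      · simp
    have e2 : MvPolynomial.pderiv j ((∑ k, (MvPolynomial.X k - MvPolynomial.C (c k))^2) - MvPolynomial.C ρ : MvPolynomial (Fin d) ℝ)
        = 2 * (MvPolynomial.X j - MvPolynomial.C (c j)) := by
      rw [map_sub, MvPolynomial.pderiv_C, sub_zero, map_sum, Finset.sum_eq_single j]
      · rw [MvPolynomial.pderiv_pow, map_sub, MvPolynomial.pderiv_C, MvPolynomial.pderiv_X_self]
        simp
      · intro k _ hk
        rw [MvPolynomial.pderiv_pow, map_sub, MvPolynomial.pderiv_C, MvPolynomial.pderiv_X_of_ne hk]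
        simp
      · simp
    simp only [hG]
    rw [map_add (MvPolynomial.pderiv j), map_add (MvPolynomial.pderiv j), e1, MvPolynomial.pderiv_C_mul, MvPolynomial.pderiv_C_mul, MvPolynomial.pderiv_pow, e2]
    simp [hq, MvPolynomial.smul_eq_C_mul]
    ring
  have hmin : ∀ n, ∃ x ∈ K, IsMinOn (fun x => MvPolynomial.eval x (G n)) K x := fun n =>
    hK.exists_isMinOn ⟨z0, hz0K⟩ (hfc (G n)).continuousOn
  choose xs hxK hxm using hmin
  set U : Ultrafilter ℕ := hyperfilter ℕ with hU
  have hUt : (U : Filter ℕ) ≤ atTop := Nat.hyperfilter_le_atTop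
  obtain ⟨x0, hx0K, hx0⟩ := hK.ultrafilter_le_nhds (U.map xs) (by
    rw [le_principal_iff]
    exact Filter.mem_map.2 (Filter.univ_mem' hxK))
  have hx0 : Tendsto xs U (𝓝 x0) := hx0
  have hn : Tendsto (fun n : ℕ => (n:ℝ)) U atTop := tendsto_natCast_atTop_atTop.mono_left hUt
  have hni : Tendsto (fun n : ℕ => (n:ℝ)⁻¹) U (𝓝 0) := tendsto_inv_atTop_zero.comp hn
  have hpos : ∀ᶠ n : ℕ in U, (0:ℝ) < n := hn.eventually_gt_atTop 0
  have hlf : ∀ r : MvPolynomial (Fin d) ℝ, Tendsto (fun n => MvPolynomial.eval (xs n) r) U (𝓝 (MvPolynomial.eval x0 r)) :=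
    fun r => ((hfc r).tendsto x0).comp hx0
  have hlq : Tendsto (fun n => q (xs n)) U (𝓝 (q x0)) := (hqc.tendsto x0).comp hx0
  have hineq : ∀ n : ℕ, n * MvPolynomial.eval (xs n) p + (n:ℝ)^2 * (q (xs n) - ρ)^2 ≤ n * MvPolynomial.eval z0 p + R z0 := by
    intro n
    have h := hxm n hz0K
    simp only [Set.mem_setOf_eq, hGe] at h
    have := hR0 (xs n)
    have e : q z0 - ρ = 0 := by simp [hρ]
    rw [e] at h
    linarith
  have hfle : MvPolynomial.eval x0 p ≤ MvPolynomial.eval z0 p := by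
    have h2 : Tendsto (fun n : ℕ => MvPolynomial.eval z0 p + R z0 * (n:ℝ)⁻¹) U (𝓝 (MvPolynomial.eval z0 p + R z0 * 0)) :=
      tendsto_const_nhds.add (tendsto_const_nhds.mul hni)
    rw [mul_zero, add_zero] at h2
    refine le_of_tendsto_of_tendsto (hlf p) h2 ?_
    filter_upwards [hpos] with n hn0
    have h := hineq n
    have h3 : (0:ℝ) ≤ (n:ℝ)^2 * (q (xs n) - ρ)^2 := by positivity
    refine le_of_mul_le_mul_left ?_ hn0
    have : (n:ℝ) * (MvPolynomial.eval z0 p + R z0 * (n:ℝ)⁻¹) = n * MvPolynomial.eval z0 p + R z0 := by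
      field_simp
    rw [this]; linarith
  have hqx : q x0 = ρ := by
    have h2 : Tendsto (fun n : ℕ => (MvPolynomial.eval z0 p - MvPolynomial.eval (xs n) p) * (n:ℝ)⁻¹ + R z0 * ((n:ℝ)⁻¹ * (n:ℝ)⁻¹)) U
        (𝓝 ((MvPolynomial.eval z0 p - MvPolynomial.eval x0 p) * 0 + R z0 * (0 * 0))) :=
      ((tendsto_const_nhds.sub (hlf p)).mul hni).add (tendsto_const_nhds.mul (hni.mul hni))
    have h1 : Tendsto (fun n => (q (xs n) - ρ)^2) U (𝓝 ((q x0 - ρ)^2)) := (hlq.sub_const ρ).pow 2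
    have h3 := le_of_tendsto_of_tendsto h1 h2 (by
      filter_upwards [hpos] with n hn0
      have h := hineq n
      have h4 : (0:ℝ) < (n:ℝ)^2 := by positivity
      refine le_of_mul_le_mul_left ?_ h4
      have : (n:ℝ)^2 * ((MvPolynomial.eval z0 p - MvPolynomial.eval (xs n) p) * (n:ℝ)⁻¹ + R z0 * ((n:ℝ)⁻¹ * (n:ℝ)⁻¹))
          = n * (MvPolynomial.eval z0 p - MvPolynomial.eval (xs n) p) + R z0 := by
        field_simp
      rw [this]; linarith)
    have h5 : (q x0 - ρ)^2 ≤ 0 := by simpa using h3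
    have := pow_eq_zero_iff (two_ne_zero) |>.1 (le_antisymm h5 (sq_nonneg _))
    linarith
  have hcrit : ∀ᶠ n : ℕ in U, ∀ j, (xs n) j ^ D + n * MvPolynomial.eval (xs n) (MvPolynomial.pderiv j p) +
      4 * (n:ℝ)^2 * (q (xs n) - ρ) * ((xs n) j - c j) = 0 := by
    have : ∀ᶠ n in U, q (xs n) < ρ + 1 := hlq.eventually_lt_const (by linarith)
    filter_upwards [this] with n hlt j
    rw [← hGd]
    refine mv_pderiv_zero _ _ ((hxm n).isLocalMin ?_) j
    filter_upwards [(isOpen_lt hqc continuous_const).mem_nhds hlt] with y hy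
    exact le_of_lt hy
  refine ⟨x0, ⟨?_, ?_, lt_of_le_of_lt hfle hz⟩, hqx, ?_⟩
  · rintro rfl; linarith
  · intro i j
    have hc : ∀ k, Tendsto (fun n => xs n k) U (𝓝 (x0 k)) := fun k => ((continuous_apply k).tendsto x0).comp hx0
    have h1 := ((hlf (MvPolynomial.pderiv i p)).mul ((hc j).sub_const (c j))).sub
      ((hlf (MvPolynomial.pderiv j p)).mul ((hc i).sub_const (c i)))
    have h2 := (hni.mul ((((hc i).pow D).mul ((hc j).sub_const (c j))).sub
      (((hc j).pow D).mul ((hc i).sub_const (c i))))).neg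
    rw [zero_mul, neg_zero] at h2
    refine tendsto_nhds_unique_of_eventuallyEq h1 h2 ?_
    filter_upwards [hcrit, hpos] with n hn hn0
    have ei := hn i
    have ej := hn j
    refine mul_left_cancel₀ hn0.ne' ?_
    rw [mul_neg, ← mul_assoc, mul_inv_cancel₀ hn0.ne', one_mul]
    linear_combination (xs n j - c j) * ei - (xs n i - c i) * ej
  · intro i
    have hc : Tendsto (fun n => xs n i - c i) U (𝓝 (x0 i - c i)) := (((continuous_apply i).tendsto x0).comp hx0).sub_const _
    refine limit_leading (W i) ρ (fun n : ℕ => (n:ℝ)) _ _ hn hc ?_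
    filter_upwards [hcrit] with n hn
    exact hW i ρ n (xs n) hn

theorem curve_eventually {d : ℕ} (p : MvPolynomial (Fin d) ℝ) (c : Fin d → ℝ) (g : ℝ → Fin d → ℝ)
    (hg : AnalyticAt ℝ g 0) (hf : ∃ᶠ s in 𝓝[>] (0:ℝ), g s ∈ lowerRadialSet p c) :
    ∃ ε > 0, (∀ s, |s| < ε → AnalyticAt ℝ g s) ∧ ∀ s ∈ Set.Ioo 0 ε, g s ∈ lowerRadialSet p c := by
  have hev : ∀ r : MvPolynomial (Fin d) ℝ, ∀ s, AnalyticAt ℝ g s →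
      AnalyticAt ℝ (fun s => MvPolynomial.eval (g s) r) s := by
    intro r s hs
    have := AnalyticAt.aeval_mvPolynomial (f := g) (z := s) (fun i => ((ContinuousLinearMap.proj (R := ℝ) (φ := fun _ : Fin d => ℝ) i).analyticAt _).comp hs) r
    simpa [MvPolynomial.aeval_eq_eval] using this
  have hco : ∀ i, AnalyticAt ℝ (fun s => g s i) 0 := fun i =>
    ((ContinuousLinearMap.proj (R := ℝ) (φ := fun _ : Fin d => ℝ) i).analyticAt _).comp hg
  have hmono : 𝓝[>] (0:ℝ) ≤ 𝓝[≠] 0 := nhdsWithin_mono _ fun x hx => ne_of_gt hx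
  have h1 : ∀ᶠ s in 𝓝 (0:ℝ), ∀ i j, MvPolynomial.eval (g s) (MvPolynomial.pderiv i p) * (g s j - c j)
      - MvPolynomial.eval (g s) (MvPolynomial.pderiv j p) * (g s i - c i) = 0 := by
    refine eventually_all.2 fun i => eventually_all.2 fun j => ?_
    have ha : AnalyticAt ℝ (fun s => MvPolynomial.eval (g s) (MvPolynomial.pderiv i p) * (g s j - c j)
      - MvPolynomial.eval (g s) (MvPolynomial.pderiv j p) * (g s i - c i)) 0 :=
      ((hev _ 0 hg).fun_mul ((hco j).fun_sub analyticAt_const)).fun_sub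
        ((hev _ 0 hg).fun_mul ((hco i).fun_sub analyticAt_const))
    refine ha.frequently_zero_iff_eventually_zero.1 ?_
    refine (hf.mono fun s hs => ?_).filter_mono hmono
    exact hs.2.1 i j
  have hF : AnalyticAt ℝ (fun s => MvPolynomial.eval (g s) p - MvPolynomial.eval c p) 0 :=
    (hev _ 0 hg).fun_sub analyticAt_const
  have h2 : ∀ᶠ s in 𝓝[≠] (0:ℝ), MvPolynomial.eval (g s) p - MvPolynomial.eval c p ≠ 0 := by
    rcases hF.eventually_eq_zero_or_eventually_ne_zero with h | h
    · exfalso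
      have h' := (h.filter_mono nhdsWithin_le_nhds : ∀ᶠ s in 𝓝[>] (0:ℝ), _)
      obtain ⟨s, hs, hs'⟩ := (hf.and_eventually h').exists
      have := hs.2.2
      linarith
    · exact h
  rw [eventually_nhdsWithin_iff] at h2
  obtain ⟨ε, hε, hb⟩ := Metric.eventually_nhds_iff.1 ((hg.eventually_analyticAt.and h1).and h2)
  have hb' : ∀ s, |s| < ε → _ := fun s hs => hb (y := s) (by simpa [Real.dist_eq] using hs)
  have hIoo : ∀ s ∈ Set.Ioo 0 ε, |s| < ε := fun s hs => by rw [abs_of_pos hs.1]; exact hs.2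
  refine ⟨ε, hε, fun s hs => (hb' s hs).1.1, ?_⟩
  obtain ⟨s0, hs0, hs0ε⟩ := (hf.and_eventually (Ioo_mem_nhdsGT hε)).exists
  intro s hs
  have hlt : MvPolynomial.eval (g s) p < MvPolynomial.eval c p := by
    by_contra hcon
    push Not at hcon
    have hcont : ContinuousOn (fun s => MvPolynomial.eval (g s) p) (Set.Ioo 0 ε) := fun u hu =>
      (hev p u (hb' u (hIoo u hu)).1.1).continuousAt.continuousWithinAt
    obtain ⟨u, hu, hu'⟩ := isPreconnected_Ioo.intermediate_value hs0ε hs hcont ⟨hs0.2.2.le, hcon⟩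
    exact (hb' u (hIoo u hu)).2 (ne_of_gt hu.1) (by simp only at hu'; linarith)
  exact ⟨fun h => by rw [h] at hlt; exact lt_irrefl _ hlt, (hb' s (hIoo s hs)).1.2, hlt⟩

theorem stmt11 (d : ℕ) (p : MvPolynomial (Fin d) ℝ) (c : Fin d → ℝ)
    (hmin : ¬ IsLocalMin (fun x => MvPolynomial.eval x p) c) :
    c ∈ closure (lowerRadialSet p c) ∧
    ∃ γ : ℝ → (Fin d → ℝ), AnalyticOnNhd ℝ γ (Set.Ico (0:ℝ) 1) ∧
      γ 0 = c ∧ ∀ t ∈ Set.Ioo (0:ℝ) 1, γ t ∈ lowerRadialSet p c := by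
  classical
  obtain ⟨D, hDe, hD3, hD⟩ : ∃ D : ℕ, Even (D+1) ∧ 3 < D ∧ ∀ i, (MvPolynomial.pderiv i p).totalDegree < D := by
    refine ⟨2 * (∑ i, (MvPolynomial.pderiv i p).totalDegree) + 5, ⟨(∑ i, (MvPolynomial.pderiv i p).totalDegree) + 3, by ring⟩, by omega, fun i => ?_⟩
    have := Finset.single_le_sum (f := fun i => (MvPolynomial.pderiv i p).totalDegree) (fun k _ => Nat.zero_le _) (Finset.mem_univ i)
    omega
  have hsys := fun i => system_algebraic p c D hD3 hD i
  choose W hW0 hW using hsys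
  have hpt : ∀ z0 : Fin d → ℝ, ∃ x0, MvPolynomial.eval z0 p < MvPolynomial.eval c p →
      x0 ∈ lowerRadialSet p c ∧ (∑ k, (x0 k - c k)^2) = (∑ k, (z0 k - c k)^2) ∧
      ∀ i, (W i).leadingCoeff.evalEval (∑ k, (z0 k - c k)^2) (x0 i - c i) = 0 := by
    intro z0
    by_cases hz : MvPolynomial.eval z0 p < MvPolynomial.eval c p
    · obtain ⟨x, h⟩ := exists_point p c D hDe W hW z0 hz
      exact ⟨x, fun _ => h⟩
    · exact ⟨c, fun h => absurd h hz⟩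
  choose X hX using hpt
  have hne : (𝓝 c ⊓ 𝓟 {z | MvPolynomial.eval z p < MvPolynomial.eval c p}).NeBot := by
    rw [inf_principal_neBot_iff]
    intro V hV
    by_contra hcon
    apply hmin
    refine Filter.mem_of_superset hV fun z hz => ?_
    by_contra hlt
    have hlt2 : MvPolynomial.eval z p < MvPolynomial.eval c p := not_le.1 hlt
    exact hcon ⟨z, hz, hlt2⟩
  set U : Ultrafilter (Fin d → ℝ) := Ultrafilter.of (𝓝 c ⊓ 𝓟 {z | MvPolynomial.eval z p < MvPolynomial.eval c p}) with hU
  have hUle : (U : Filter (Fin d → ℝ)) ≤ 𝓝 c ⊓ 𝓟 {z | MvPolynomial.eval z p < MvPolynomial.eval c p} := Ultrafilter.of_le _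
  have hUc : Tendsto (fun z : Fin d → ℝ => z) U (𝓝 c) := hUle.trans inf_le_left
  have hUf : ∀ᶠ z in U, MvPolynomial.eval z p < MvPolynomial.eval c p :=
    (hUle.trans inf_le_right) (mem_principal_self _)
  set t : (Fin d → ℝ) → ℝ := fun z => ∑ k, (z k - c k)^2 with ht
  have htc : Continuous t := by fun_prop
  have ht0 : Tendsto t U (𝓝 0) := by
    have := (htc.tendsto c).comp hUc
    have e : t c = 0 := by simp [ht]
    rw [e] at this
    exact this
  have htp : ∀ᶠ z in U, 0 < t z := by
    filter_upwards [hUf] with z hz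
    refine lt_of_le_of_ne (Finset.sum_nonneg fun k _ => sq_nonneg _) fun h => ?_
    have h' := (Finset.sum_eq_zero_iff_of_nonneg (fun k _ => sq_nonneg _)).1 h.symm
    have : z = c := by
      ext k
      have := pow_eq_zero_iff (two_ne_zero) |>.1 (h' k (Finset.mem_univ k))
      linarith
    rw [this] at hz
    exact lt_irrefl _ hz
  have ht1 : Tendsto t U (𝓝[>] 0) := tendsto_nhdsWithin_iff.2 ⟨ht0, htp⟩
  have hXm : ∀ᶠ z in U, X z ∈ lowerRadialSet p c := hUf.mono fun z hz => (hX z hz).1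
  have hy : ∀ i, Tendsto (fun z => X z i - c i) U (𝓝 0) := by
    intro i
    have hs : Tendsto (fun z => Real.sqrt (t z)) U (𝓝 0) := by
      have := (Real.continuous_sqrt.tendsto 0).comp ht0
      rw [Real.sqrt_zero] at this
      exact this
    refine squeeze_zero_norm' ?_ hs
    filter_upwards [hUf] with z hz
    rw [Real.norm_eq_abs]
    apply Real.abs_le_sqrt
    have h2 := (hX z hz).2.1
    show _ ≤ ∑ k, (z k - c k)^2
    rw [← h2]
    exact Finset.single_le_sum (f := fun k => (X z k - c k)^2) (fun k _ => sq_nonneg _) (Finset.mem_univ i)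
  have hXc : Tendsto X U (𝓝 c) := by
    rw [tendsto_pi_nhds]
    intro i
    simpa using (hy i).add_const (c i)
  refine ⟨mem_closure_of_tendsto hXc hXm, ?_⟩
  have hP := fun i => puiseux_poly U (W i).leadingCoeff (Polynomial.leadingCoeff_ne_zero.2 (hW0 i)) t
    (fun z => X z i - c i) ht1 (hy i) (hUf.mono fun z hz => (hX z hz).2.2 i)
  choose N hN h hh he using hP
  set NN := ∏ i, N i with hNN
  have hNN0 : 0 < NN := Finset.prod_pos fun i _ => hN i
  set m : Fin d → ℕ := fun i => ∏ j ∈ Finset.univ.erase i, N j with hm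
  have hm0 : ∀ i, 0 < m i := fun i => Finset.prod_pos fun i _ => hN i
  have hmN : ∀ i, m i * N i = NN := fun i => Finset.prod_erase_mul _ _ (Finset.mem_univ i)
  set g : ℝ → Fin d → ℝ := fun s i => c i + h i (s ^ m i) with hgd
  have hg : AnalyticAt ℝ g 0 := by
    refine AnalyticAt.pi fun i => ?_
    refine analyticAt_const.fun_add ?_
    refine AnalyticAt.fun_comp (g := h i) (f := fun s : ℝ => s ^ m i) ?_ (analyticAt_id.pow _)
    simpa [(hm0 i).ne'] using hh i
  set σ : (Fin d → ℝ) → ℝ := fun z => t z ^ ((NN : ℝ)⁻¹) with hσ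
  have hσ0 : Tendsto σ U (𝓝 0) := by
    have hp : (0:ℝ) < (NN:ℝ)⁻¹ := by positivity
    have := (Real.continuousAt_rpow_const 0 ((NN:ℝ)⁻¹) (Or.inr hp.le)).tendsto.comp ht0
    rw [Real.zero_rpow hp.ne'] at this
    exact this
  have hσp : ∀ᶠ z in U, 0 < σ z := htp.mono fun z hz => Real.rpow_pos_of_pos hz _
  have hσ1 : Tendsto σ U (𝓝[>] 0) := tendsto_nhdsWithin_iff.2 ⟨hσ0, hσp⟩
  have hgX : ∀ᶠ z in U, g (σ z) = X z := by
    filter_upwards [eventually_all.2 he, htp, hσp] with z hz hzt hzs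
    ext i
    have h1 : (σ z ^ m i) ^ N i = t z := by
      rw [← pow_mul, hmN]
      exact Real.rpow_inv_natCast_pow hzt.le hNN0.ne'
    have := hz i (σ z ^ m i) (by positivity) h1
    simp only [hgd]
    linarith
  have hg0 : g 0 = c := by
    have h1 := hg.continuousAt.tendsto.comp hσ0
    exact tendsto_nhds_unique_of_eventuallyEq h1 hXc hgX
  have hfr : ∃ᶠ s in 𝓝[>] (0:ℝ), g s ∈ lowerRadialSet p c := by
    refine hσ1.frequently (Eventually.frequently ?_)
    filter_upwards [hgX, hXm] with z h1 h2
    rw [h1]; exact h2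
  obtain ⟨ε, hε, ha, hs⟩ := curve_eventually p c g hg hfr
  refine ⟨fun τ => g (ε * τ), ?_, by simpa using hg0, ?_⟩
  · intro τ hτ
    refine AnalyticAt.fun_comp (g := g) (f := fun τ : ℝ => ε * τ) (ha _ ?_) (analyticAt_const.fun_mul analyticAt_id)
    rw [abs_of_nonneg (mul_nonneg hε.le hτ.1)]
    nlinarith [hτ.2]
  · intro τ hτ
    exact hs _ ⟨mul_pos hε hτ.1, by nlinarith [hτ.2]⟩
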